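/- arXiv:2101.06262 — 2 statements merged into one kernel-verified Lean document; each statement's English description precedes it below -/
import Mathlib

section
/- Let R : ℝ^{m×n} → ℝ be differentiable, and for each matrix A let ∇R(A) denote its gradient with respect to the Frobenius inner product, i.e., the unique matrix G such that the Fréchet derivative of R at A is the linear map H ↦ ⟨G, H⟩. Let U be a real m×r matrix, V a real n×r matrix, and suppose X ∈ ℝ^{r×r} minimizes the function X ↦ R(U X Vᵀ) over all r×r real matrices. Set A = U X Vᵀ. Then for every vector u in the column span of U and every vector v in the column span of V, one has ⟨∇R(A), u vᵀ⟩ = 0; equivalently, Uᵀ ∇R(A) V = 0. -/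
open Matrix

attribute [local instance] Matrix.frobeniusNormedAddCommGroup Matrix.frobeniusNormedSpace

/-- Frobenius inner product: ⟨A,B⟩ = trace(AᵀB). -/
def frobInner {m n : ℕ} (A B : Matrix (Fin m) (Fin n) ℝ) : ℝ := (Aᵀ * B).trace

/-- The continuous linear map `H ↦ ⟨G, H⟩` (Frobenius inner product against `G`). -/
noncomputable def frobCLM {m n : ℕ} (G : Matrix (Fin m) (Fin n) ℝ) :
    Matrix (Fin m) (Fin n) ℝ →L[ℝ] ℝ :=
  LinearMap.toContinuousLinearMap
    { toFun := fun H => frobInner G H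
      map_add' := by intro a b; simp [frobInner, Matrix.mul_add]
      map_smul' := by intro c a; simp [frobInner, Matrix.mul_smul] }

/-- If `R` restricted to the line `A + ℝ H` is minimal at `A`, its gradient at `A` is orthogonal
to `H`. -/
theorem frobInner_eq_zero_of_forall_le {m n : ℕ} {R : Matrix (Fin m) (Fin n) ℝ → ℝ}
    {G A H : Matrix (Fin m) (Fin n) ℝ} (hderiv : HasFDerivAt R (frobCLM G) A)
    (hmin : ∀ t : ℝ, R A ≤ R (A + t • H)) : frobInner G H = 0 := by
  have hline : HasDerivAt (fun t : ℝ => R (A + t • H)) (frobCLM G H) 0 :=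
    hderiv.hasLineDerivAt H
  refine IsLocalMin.hasDerivAt_eq_zero (Filter.Eventually.of_forall fun t => ?_) hline
  simpa using hmin t

theorem frobInner_mul_mul_transpose {m n r : ℕ} (G : Matrix (Fin m) (Fin n) ℝ)
    (U : Matrix (Fin m) (Fin r) ℝ) (V : Matrix (Fin n) (Fin r) ℝ)
    (H : Matrix (Fin r) (Fin r) ℝ) :
    frobInner G (U * H * Vᵀ) = frobInner (Uᵀ * G * V) H := by
  simp only [frobInner, transpose_mul, transpose_transpose]
  rw [← Matrix.mul_assoc, trace_mul_comm]
  simp only [Matrix.mul_assoc]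

theorem frobInner_self_eq_zero {m n : ℕ} {A : Matrix (Fin m) (Fin n) ℝ} :
    frobInner A A = 0 ↔ A = 0 := by
  rw [frobInner, ← conjTranspose_eq_transpose_of_trivial]
  exact trace_conjTranspose_mul_self_eq_zero_iff

/-- If `R` is differentiable with Frobenius gradient `G`, and `X` minimizes
`X ↦ R(U X Vᵀ)`, then with `A = U X Vᵀ`, for all `u` in the column span of `U` and `v` in
the column span of `V`, `⟨∇R(A), u vᵀ⟩ = 0`; equivalently `Uᵀ ∇R(A) V = 0`. -/
theorem stmt1 {m n r : ℕ}
    (R : Matrix (Fin m) (Fin n) ℝ → ℝ)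
    (G : Matrix (Fin m) (Fin n) ℝ → Matrix (Fin m) (Fin n) ℝ)
    (hderiv : ∀ A, HasFDerivAt R (frobCLM (G A)) A)
    (U : Matrix (Fin m) (Fin r) ℝ) (V : Matrix (Fin n) (Fin r) ℝ)
    (X : Matrix (Fin r) (Fin r) ℝ)
    (hmin : ∀ Y : Matrix (Fin r) (Fin r) ℝ, R (U * X * Vᵀ) ≤ R (U * Y * Vᵀ)) :
    (∀ u ∈ Submodule.span ℝ (Set.range Uᵀ), ∀ v ∈ Submodule.span ℝ (Set.range Vᵀ),
        frobInner (G (U * X * Vᵀ)) (Matrix.vecMulVec u v) = 0) ∧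
      Uᵀ * G (U * X * Vᵀ) * V = 0 := by
  have horth : ∀ H : Matrix (Fin r) (Fin r) ℝ,
      frobInner (G (U * X * Vᵀ)) (U * H * Vᵀ) = 0 := fun H =>
    frobInner_eq_zero_of_forall_le (hderiv _) fun t => by
      simpa [Matrix.mul_add, Matrix.add_mul] using hmin (X + t • H)
  refine ⟨fun u hu v hv => ?_, ?_⟩
  · obtain ⟨a, rfl⟩ : u ∈ LinearMap.range U.mulVecLin := by
      rwa [range_mulVecLin]
    obtain ⟨b, rfl⟩ : v ∈ LinearMap.range V.mulVecLin := by
      rwa [range_mulVecLin]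
    simpa [mul_vecMulVec, vecMulVec_mul, vecMul_transpose] using horth (vecMulVec a b)
  · rw [← frobInner_self_eq_zero, ← frobInner_mul_mul_transpose]
    exact horth _
end

section
/- Let U, U* be real m×r and m×r* matrices, and V, V* be real n×r and n×r* matrices. Let Π_U denote the orthogonal projection onto the column span of U and Π_V the orthogonal projection onto the column span of V. Define U¹ = Π_U U*, U² = U* − U¹, V¹ = Π_V V*, V² = V* − V¹. Then: (i) U*V*ᵀ − UVᵀ = (U¹V¹ᵀ − UVᵀ) + U¹V²ᵀ + U²V*ᵀ; (ii) rank(U¹V²ᵀ) ≤ rank(V*) ≤ r* and rank(U²V*ᵀ) ≤ rank(U*) ≤ r*; and (iii) ‖U*V*ᵀ − UVᵀ‖_F² = ‖U¹V¹ᵀ − UVᵀ‖_F² + ‖U¹V²ᵀ‖_F² + ‖U²V*ᵀ‖_F². -/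
open Matrix

/-- Squared Frobenius norm: ‖A‖_F² = trace(AᵀA). -/
def frobSq {m n : ℕ} (A : Matrix (Fin m) (Fin n) ℝ) : ℝ := (Aᵀ * A).trace

/-- `P` is the orthogonal projection (as an m×m matrix) onto the column span of `U`:
for every `x`, `P x` lies in the column span of `U` and `x - P x` is orthogonal to it. -/
def IsOrthProjOntoColSpan {m r : ℕ} (P : Matrix (Fin m) (Fin m) ℝ)
    (U : Matrix (Fin m) (Fin r) ℝ) : Prop :=
  ∀ x : Fin m → ℝ, P.mulVec x ∈ Submodule.span ℝ (Set.range Uᵀ) ∧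
    ∀ y ∈ Submodule.span ℝ (Set.range Uᵀ), (x - P.mulVec x) ⬝ᵥ y = 0

theorem IsOrthProjOntoColSpan.transpose_mul_self {m r : ℕ} {P : Matrix (Fin m) (Fin m) ℝ}
    {U : Matrix (Fin m) (Fin r) ℝ} (h : IsOrthProjOntoColSpan P U) : Pᵀ * P = Pᵀ := by
  refine Matrix.ext_of_mulVec_single fun i ↦ dotProduct_eq _ _ fun y ↦ ?_
  have hy := (h (Pi.single i 1)).2 _ (h y).1
  rw [sub_dotProduct, sub_eq_zero] at hy
  rw [← mulVec_mulVec, mulVec_transpose, mulVec_transpose, ← dotProduct_mulVec,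
    ← dotProduct_mulVec, hy]

theorem IsOrthProjOntoColSpan.transpose_eq {m r : ℕ} {P : Matrix (Fin m) (Fin m) ℝ}
    {U : Matrix (Fin m) (Fin r) ℝ} (h : IsOrthProjOntoColSpan P U) : Pᵀ = P := by
  have h' := congrArg transpose h.transpose_mul_self
  rw [transpose_mul, transpose_transpose, h.transpose_mul_self] at h'
  exact h'

theorem IsOrthProjOntoColSpan.mul_self {m r : ℕ} {P : Matrix (Fin m) (Fin m) ℝ}
    {U : Matrix (Fin m) (Fin r) ℝ} (h : IsOrthProjOntoColSpan P U) : P * P = P := by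
  simpa only [h.transpose_eq] using h.transpose_mul_self

theorem IsOrthProjOntoColSpan.mul_eq {m r : ℕ} {P : Matrix (Fin m) (Fin m) ℝ}
    {U : Matrix (Fin m) (Fin r) ℝ} (h : IsOrthProjOntoColSpan P U) : P * U = U := by
  have key : Pᵀ * U = U := by
    ext i j
    have hij := (h (Pi.single i 1)).2 _ (Submodule.subset_span ⟨j, rfl⟩)
    rw [sub_dotProduct, sub_eq_zero, single_one_dotProduct, mulVec_single_one] at hij
    exact hij.symm
  rwa [h.transpose_eq] at key

theorem frobSq_add {m n : ℕ} {A B : Matrix (Fin m) (Fin n) ℝ} (h : (Aᵀ * B).trace = 0) :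
    frobSq (A + B) = frobSq A + frobSq B := by
  have h' : (Bᵀ * A).trace = 0 := by
    rw [← trace_transpose, transpose_mul, transpose_transpose, h]
  simp only [frobSq, transpose_add, Matrix.add_mul, Matrix.mul_add, trace_add, h, h']
  ring

/-- With `U¹ = Π_U U*`, `U² = U* − U¹`, `V¹ = Π_V V*`, `V² = V* − V¹` (where `Π_U`, `Π_V` are
the orthogonal projections onto the column spans of `U`, `V`), one has:
(i) U*V*ᵀ − UVᵀ = (U¹V¹ᵀ − UVᵀ) + U¹V²ᵀ + U²V*ᵀ;
(ii) rank(U¹V²ᵀ) ≤ rank(V*) ≤ r* and rank(U²V*ᵀ) ≤ rank(U*) ≤ r*;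
(iii) ‖U*V*ᵀ − UVᵀ‖_F² = ‖U¹V¹ᵀ − UVᵀ‖_F² + ‖U¹V²ᵀ‖_F² + ‖U²V*ᵀ‖_F². -/
theorem stmt6 {m n r rs : ℕ}
    (U : Matrix (Fin m) (Fin r) ℝ) (Us : Matrix (Fin m) (Fin rs) ℝ)
    (V : Matrix (Fin n) (Fin r) ℝ) (Vs : Matrix (Fin n) (Fin rs) ℝ)
    (PU : Matrix (Fin m) (Fin m) ℝ) (PV : Matrix (Fin n) (Fin n) ℝ)
    (hPU : IsOrthProjOntoColSpan PU U) (hPV : IsOrthProjOntoColSpan PV V) :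
    Us * Vsᵀ - U * Vᵀ =
        ((PU * Us) * (PV * Vs)ᵀ - U * Vᵀ) + (PU * Us) * (Vs - PV * Vs)ᵀ
          + (Us - PU * Us) * Vsᵀ ∧
      ((PU * Us) * (Vs - PV * Vs)ᵀ).rank ≤ Vs.rank ∧ Vs.rank ≤ rs ∧
      ((Us - PU * Us) * Vsᵀ).rank ≤ Us.rank ∧ Us.rank ≤ rs ∧
      frobSq (Us * Vsᵀ - U * Vᵀ) =
        frobSq ((PU * Us) * (PV * Vs)ᵀ - U * Vᵀ) + frobSq ((PU * Us) * (Vs - PV * Vs)ᵀ)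
          + frobSq ((Us - PU * Us) * Vsᵀ) := by
  have decomp : Us * Vsᵀ - U * Vᵀ =
      ((PU * Us) * (PV * Vs)ᵀ - U * Vᵀ) + (PU * Us) * (Vs - PV * Vs)ᵀ
        + (Us - PU * Us) * Vsᵀ := by
    simp only [transpose_sub, Matrix.mul_sub, Matrix.sub_mul]
    abel
  refine ⟨decomp, ?_, Vs.rank_le_width, ?_, Us.rank_le_width, ?_⟩
  · calc ((PU * Us) * (Vs - PV * Vs)ᵀ).rank
        ≤ (Vs - PV * Vs)ᵀ.rank := rank_mul_le_right _ _
      _ = ((1 - PV) * Vs).rank := by rw [rank_transpose, Matrix.sub_mul, Matrix.one_mul]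
      _ ≤ Vs.rank := rank_mul_le_right _ _
  · calc ((Us - PU * Us) * Vsᵀ).rank
        ≤ (Us - PU * Us).rank := rank_mul_le_left _ _
      _ = ((1 - PU) * Us).rank := by rw [Matrix.sub_mul, Matrix.one_mul]
      _ ≤ Us.rank := rank_mul_le_right _ _
  · have hAB : (((PU * Us) * (PV * Vs)ᵀ - U * Vᵀ)ᵀ * ((PU * Us) * (Vs - PV * Vs)ᵀ)).trace = 0 := by
      have hA : PV * ((PU * Us) * (PV * Vs)ᵀ - U * Vᵀ)ᵀ =
          ((PU * Us) * (PV * Vs)ᵀ - U * Vᵀ)ᵀ := by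
        simp only [transpose_sub, transpose_mul, transpose_transpose, Matrix.mul_sub,
          ← Matrix.mul_assoc, hPV.mul_self, hPV.mul_eq]
      have hB : ((PU * Us) * (Vs - PV * Vs)ᵀ) * PV = 0 := by
        simp only [transpose_sub, transpose_mul, Matrix.mul_sub, Matrix.sub_mul,
          Matrix.mul_assoc, hPV.transpose_eq, hPV.mul_self, sub_self]
      rw [← hA, Matrix.mul_assoc, trace_mul_comm, Matrix.mul_assoc, hB, Matrix.mul_zero,
        trace_zero]
    have hC : PU * ((Us - PU * Us) * Vsᵀ) = 0 := by
      simp only [Matrix.mul_sub, Matrix.sub_mul, ← Matrix.mul_assoc, hPU.mul_self, sub_self]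
    have hD : PU * (((PU * Us) * (PV * Vs)ᵀ - U * Vᵀ) + (PU * Us) * (Vs - PV * Vs)ᵀ) =
        ((PU * Us) * (PV * Vs)ᵀ - U * Vᵀ) + (PU * Us) * (Vs - PV * Vs)ᵀ := by
      simp only [Matrix.mul_add, Matrix.mul_sub, ← Matrix.mul_assoc, hPU.mul_self, hPU.mul_eq]
    rw [decomp, frobSq_add, frobSq_add hAB]
    rw [← hD, transpose_mul, hPU.transpose_eq, Matrix.mul_assoc, hC, Matrix.mul_zero, trace_zero]
end
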